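/- For every integer n ≥ 1, the triple sum W_3(n) in ℚ(q) satisfies: W_3(n) = ((-1)^k/2)(q^{9k^2-9k+3} - 3 q^{9k^2-11k+3}) if n = 2k-1 is odd, and W_3(n) = ((-1)^{k-1}/2)(q^{9k^2-3k} - 3 q^{9k^2-k}) if n = 2k is even. -/

import Mathlib

open Finset

noncomputable def q : RatFunc ℚ := RatFunc.X

noncomputable def qPoch (a : RatFunc ℚ) (n : ℕ) : RatFunc ℚ :=
  ∏ k ∈ Finset.range n, (1 - a * q ^ k)

noncomputable def qPochZ (a : RatFunc ℚ) (n : ℤ) : RatFunc ℚ :=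
  if 0 ≤ n then qPoch a n.toNat else 1 / qPoch (a * q ^ n) (-n).toNat

noncomputable def qbinom (n m : ℤ) : RatFunc ℚ :=
  if 0 ≤ m ∧ m ≤ n then
    qPoch q n.toNat / (qPoch q m.toNat * qPoch q (n - m).toNat)
  else 0

/-- The multiple sum `U_m(n)`, with the cyclic convention `r_{m+1} = r_1`. -/
noncomputable def Umul (m : ℕ) [NeZero m] (n : ℕ) : RatFunc ℚ :=
  ∑ r ∈ Fintype.piFinset (fun _ : Fin m => Finset.range (2 * n + 2)),
    ∏ k : Fin m,
      ((-1 : RatFunc ℚ) ^ r k * q ^ (r k * (r k - 1) / 2) *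
        qPochZ (-q) ((n : ℤ) - r k) * qbinom (2 * (n : ℤ) - r k + 1) (r (k + 1)))

/-- The multiple sum `W_m(n)`, with the cyclic convention `r_{m+1} = r_1`. -/
noncomputable def Wmul (m : ℕ) [NeZero m] (n : ℕ) : RatFunc ℚ :=
  ∑ r ∈ Fintype.piFinset (fun _ : Fin m => Finset.range (2 * n + 1)),
    ∏ k : Fin m,
      ((-1 : RatFunc ℚ) ^ r k * q ^ (r k * (r k - 1) / 2) *
        qPochZ (-q) ((n : ℤ) - r k) * qbinom (2 * (n : ℤ) - r k) (r (k + 1)))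

/-! ### The indeterminate `q` -/

lemma q_ne_zero : q ≠ 0 := RatFunc.X_ne_zero

lemma q_pow_ne_one {k : ℕ} (hk : k ≠ 0) : q ^ k ≠ 1 := by
  intro h
  have h' : algebraMap (Polynomial ℚ) (RatFunc ℚ) (Polynomial.X ^ k) = algebraMap _ _ 1 := by
    rw [map_pow, map_one, RatFunc.algebraMap_X]
    exact h
  have h2 := congrArg Polynomial.natDegree (RatFunc.algebraMap_injective ℚ h')
  simp at h2
  exact hk h2

lemma one_sub_q_pow_ne_zero {k : ℕ} (hk : k ≠ 0) : 1 - q ^ k ≠ 0 :=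
  sub_ne_zero.mpr (q_pow_ne_one hk).symm

lemma one_add_q_pow_ne_zero (k : ℕ) : 1 + q ^ k ≠ 0 := by
  rcases Nat.eq_zero_or_pos k with rfl | hk
  · norm_num
  · intro h
    refine q_pow_ne_one (k := k * 2) (by omega) ?_
    rw [pow_mul, eq_neg_of_add_eq_zero_right h]
    norm_num

lemma one_add_q_zpow_ne_zero (i : ℤ) : 1 + q ^ i ≠ 0 := by
  obtain ⟨k, rfl | rfl⟩ := i.eq_nat_or_neg
  · exact_mod_cast one_add_q_pow_ne_zero k
  · have h := one_add_q_pow_ne_zero k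
    have h0 : q ^ k ≠ 0 := pow_ne_zero _ q_ne_zero
    rw [zpow_neg, zpow_natCast]
    intro h1
    apply h
    field_simp at h1
    linear_combination h1

/-! ### Shifted factorials -/

lemma qPoch_zero (a : RatFunc ℚ) : qPoch a 0 = 1 := by simp [qPoch]

lemma qPoch_succ (a : RatFunc ℚ) (n : ℕ) : qPoch a (n + 1) = qPoch a n * (1 - a * q ^ n) := by
  simp [qPoch, Finset.prod_range_succ]

lemma qPoch_succ' (a : RatFunc ℚ) (n : ℕ) : qPoch a (n + 1) = (1 - a) * qPoch (a * q) n := by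
  simp only [qPoch, Finset.prod_range_succ', pow_zero, mul_one]
  rw [mul_comm]
  congr 1
  refine Finset.prod_congr rfl fun k _ => ?_
  ring

lemma qPoch_q_succ (n : ℕ) : qPoch q (n + 1) = qPoch q n * (1 - q ^ (n + 1)) := by
  rw [qPoch_succ, pow_succ' q n]

lemma qPoch_q_ne_zero (n : ℕ) : qPoch q n ≠ 0 := by
  induction n with
  | zero => simp [qPoch_zero]
  | succ n ih =>
    rw [qPoch_q_succ]
    exact mul_ne_zero ih (one_sub_q_pow_ne_zero n.succ_ne_zero)

lemma qPochZ_neg_q_natCast (m : ℕ) : qPochZ (-q) m = qPoch (-q) m := by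
  simp [qPochZ]

lemma qPochZ_neg_q_neg (m : ℕ) : qPochZ (-q) (-m : ℤ) = 1 / qPoch (-q ^ (1 - m : ℤ)) m := by
  rcases Nat.eq_zero_or_pos m with rfl | hm
  · simp [qPochZ, qPoch_zero]
  · rw [qPochZ, if_neg (by omega), sub_eq_add_neg, zpow_add₀ q_ne_zero]
    simp

lemma qPochZ_neg_q_add_one (i : ℤ) :
    qPochZ (-q) (i + 1) = qPochZ (-q) i * (1 + q ^ (i + 1)) := by
  rcases le_or_gt 0 i with hi | hi
  · obtain ⟨m, rfl⟩ := Int.eq_ofNat_of_zero_le hi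
    have h := qPochZ_neg_q_natCast (m + 1)
    push_cast at h
    rw [h, qPochZ_neg_q_natCast, qPoch_succ]
    norm_cast
    rw [pow_succ' q m]
    ring
  · obtain ⟨m, rfl⟩ : ∃ m : ℕ, i = -((m + 1 : ℕ) : ℤ) := ⟨(-i).toNat - 1, by omega⟩
    have h1 : -((m + 1 : ℕ) : ℤ) + 1 = -(m : ℤ) := by push_cast; ring
    have h2 : (1 - ((m + 1 : ℕ) : ℤ)) = -(m : ℤ) := by push_cast; ring
    have h3 : -q ^ (-(m : ℤ)) * q = -q ^ (1 - m : ℤ) := by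
      rw [sub_eq_add_neg, add_comm, zpow_add₀ q_ne_zero, zpow_one]
      ring
    rw [h1, qPochZ_neg_q_neg, qPochZ_neg_q_neg, h2, qPoch_succ', h3, sub_neg_eq_add, one_div,
      one_div, mul_inv, mul_right_comm, inv_mul_cancel₀ (one_add_q_zpow_ne_zero _), one_mul]

lemma qPochZ_neg_q_add (i : ℤ) (m : ℕ) :
    qPochZ (-q) (i + m) = qPochZ (-q) i * ∏ k ∈ range m, (1 + q ^ (i + 1) * q ^ k) := by
  induction m with
  | zero => simp
  | succ m ih =>
    have h : q ^ (i + m + 1) = q ^ (i + 1) * q ^ m := by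
      rw [← zpow_natCast, ← zpow_add₀ q_ne_zero]
      congr 1
      ring
    rw [Nat.cast_succ, ← add_assoc, qPochZ_neg_q_add_one, ih, prod_range_succ, h, mul_assoc]

lemma q_pow_choose_succ (m : ℕ) : q ^ (m + 1).choose 2 = q ^ m * q ^ m.choose 2 := by
  rw [Nat.choose_succ_succ' m 1, Nat.choose_one_right, pow_add]

/-- The product of `(-q;q)_m` and `(-q;q)_{-m}`. -/
lemma qPochZ_neg_q_mul_neg (m : ℕ) :
    2 * (qPochZ (-q) m * qPochZ (-q) (-m : ℤ)) = q ^ m.choose 2 * (1 + q ^ m) := by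
  induction m with
  | zero => norm_num [qPochZ, qPoch_zero]
  | succ m ih =>
    have h1 := qPochZ_neg_q_add_one m
    have h2 := qPochZ_neg_q_add_one (-((m + 1 : ℕ) : ℤ))
    have h3 : -((m + 1 : ℕ) : ℤ) + 1 = -(m : ℤ) := by push_cast; ring
    rw [h3] at h2
    rw [h2] at ih
    have h0 : q ^ m ≠ 0 := pow_ne_zero _ q_ne_zero
    have h4 := one_add_q_pow_ne_zero m
    rw [zpow_neg, zpow_natCast] at ih
    have h5 : q ^ ((m : ℤ) + 1) = q ^ (m + 1) := by norm_cast
    rw [Nat.cast_succ] at ih ⊢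
    rw [h1, h5, q_pow_choose_succ]
    apply mul_right_cancel₀ h4
    field_simp at ih
    linear_combination (1 + q ^ (m + 1)) * ih

/-! ### Gaussian binomial coefficients -/

/-- The Gaussian binomial coefficient with natural number arguments. -/
noncomputable def gaussBinom (n m : ℕ) : RatFunc ℚ :=
  if m ≤ n then qPoch q n / (qPoch q m * qPoch q (n - m)) else 0

lemma qbinom_natCast (n m : ℕ) : qbinom n m = gaussBinom n m := by
  simp only [qbinom, gaussBinom, Nat.cast_nonneg, true_and, Nat.cast_le, Int.toNat_natCast]
  congr 4
  omega

lemma gaussBinom_of_lt {n m : ℕ} (h : n < m) : gaussBinom n m = 0 := if_neg (by omega)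

lemma gaussBinom_add (a b : ℕ) :
    gaussBinom (a + b) a = qPoch q (a + b) / (qPoch q a * qPoch q b) := by
  simp [gaussBinom]

lemma gaussBinom_zero (n : ℕ) : gaussBinom n 0 = 1 := by
  simp [gaussBinom, qPoch_zero, qPoch_q_ne_zero]

lemma gaussBinom_self (n : ℕ) : gaussBinom n n = 1 := by
  simp [gaussBinom, qPoch_zero, qPoch_q_ne_zero]

lemma gaussBinom_symm (a b : ℕ) : gaussBinom (a + b) a = gaussBinom (a + b) b := by
  rw [gaussBinom_add, add_comm a b, gaussBinom_add, mul_comm]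

lemma gaussBinom_succ_succ (n m : ℕ) :
    gaussBinom (n + 1) (m + 1) = gaussBinom n m + q ^ (m + 1) * gaussBinom n (m + 1) := by
  rcases lt_trichotomy n m with h | rfl | h
  · simp [gaussBinom_of_lt, h, h.trans]
  · simp [gaussBinom_self, gaussBinom_of_lt]
  · obtain ⟨d, rfl⟩ := Nat.exists_eq_add_of_lt h
    have e1 : m + d + 1 + 1 = (m + 1) + (d + 1) := by ring
    have e2 : m + d + 1 = m + (d + 1) := by ring
    have e3 : m + (d + 1) = (m + 1) + d := by ring
    rw [e1, e2, gaussBinom_add, gaussBinom_add, e3, gaussBinom_add, ← add_assoc (m + 1) d 1,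
      qPoch_q_succ (m + 1 + d), qPoch_q_succ m, qPoch_q_succ d]
    have h1 := qPoch_q_ne_zero m
    have h2 := qPoch_q_ne_zero d
    have h3 := one_sub_q_pow_ne_zero m.succ_ne_zero
    have h4 := one_sub_q_pow_ne_zero d.succ_ne_zero
    field_simp
    ring

lemma gaussBinom_succ_succ' {n m : ℕ} (h : m ≤ n) :
    gaussBinom (n + 1) (m + 1) = q ^ (n - m) * gaussBinom n m + gaussBinom n (m + 1) := by
  obtain ⟨d, rfl⟩ := Nat.exists_eq_add_of_le h
  rcases d with _ | d
  · simp [gaussBinom_self, gaussBinom_of_lt]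
  · have e : m + (d + 1) + 1 = (m + 1) + (d + 1) := by ring
    rw [e, gaussBinom_symm, ← add_assoc (m + 1) d 1, gaussBinom_succ_succ, add_tsub_cancel_left,
      ← gaussBinom_symm, show m + 1 + d = m + (d + 1) by ring, ← gaussBinom_symm m (d + 1)]
    ring

lemma gaussBinom_mul {n k s : ℕ} (hsk : s ≤ k) (hkn : k ≤ n) :
    gaussBinom n k * gaussBinom k s = gaussBinom n s * gaussBinom (n - s) (k - s) := by
  obtain ⟨a, rfl⟩ := Nat.exists_eq_add_of_le hsk
  obtain ⟨b, rfl⟩ := Nat.exists_eq_add_of_le hkn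
  rw [gaussBinom_add, gaussBinom_add, show s + a + b - s = a + b by omega, add_tsub_cancel_left,
    gaussBinom_add, add_assoc s a b, gaussBinom_add]
  have h1 := qPoch_q_ne_zero s
  have h2 := qPoch_q_ne_zero a
  have h3 := qPoch_q_ne_zero b
  have h4 := qPoch_q_ne_zero (s + a)
  have h5 := qPoch_q_ne_zero (a + b)
  field_simp

lemma gaussBinom_mul_sub {n i s : ℕ} (h : i + s ≤ n) :
    gaussBinom n i * gaussBinom (n - i) s = gaussBinom n s * gaussBinom (n - s) i := by
  obtain ⟨b, rfl⟩ := Nat.exists_eq_add_of_le h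
  rw [show i + s + b - i = s + b by omega, show i + s + b - s = i + b by omega, gaussBinom_add,
    gaussBinom_add, add_assoc, gaussBinom_add, add_left_comm, gaussBinom_add]
  have h1 := qPoch_q_ne_zero s
  have h2 := qPoch_q_ne_zero i
  have h3 := qPoch_q_ne_zero b
  have h4 := qPoch_q_ne_zero (s + b)
  have h5 := qPoch_q_ne_zero (i + b)
  field_simp

/-- The finite `q`-binomial theorem. -/
lemma sum_gaussBinom_mul_pow (m : ℕ) (z : RatFunc ℚ) :
    ∑ i ∈ range (m + 1), gaussBinom m i * q ^ i.choose 2 * z ^ i =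
      ∏ k ∈ range m, (1 + z * q ^ k) := by
  induction m generalizing z with
  | zero => simp [gaussBinom_zero]
  | succ m ih =>
    have h : ∀ i ∈ range (m + 1), gaussBinom (m + 1) (i + 1) * q ^ (i + 1).choose 2 * z ^ (i + 1) =
        gaussBinom m (i + 1) * q ^ (i + 1).choose 2 * (z * q) ^ (i + 1) +
          z * (gaussBinom m i * q ^ i.choose 2 * (z * q) ^ i) := by
      intro i _
      rw [gaussBinom_succ_succ, q_pow_choose_succ]
      ring
    have h1 := ih (z * q)
    rw [sum_range_succ'] at h1
    rw [sum_range_succ', sum_congr rfl h, sum_add_distrib, ← mul_sum, ih, sum_range_succ,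
      gaussBinom_of_lt (Nat.lt_succ_self m), prod_range_succ']
    have h2 : ∏ k ∈ range m, (1 + z * q ^ (k + 1)) = ∏ k ∈ range m, (1 + z * q * q ^ k) :=
      prod_congr rfl fun k _ => by ring
    rw [h2]
    simp only [gaussBinom_zero, Nat.choose_zero_succ, pow_zero, mul_one] at h1 ⊢
    linear_combination h1

lemma sum_range_eq_sum_shift {N r m : ℕ} (F : ℕ → RatFunc ℚ) (h : r + m ≤ N)
    (hlt : ∀ t, t < r → F t = 0) (hgt : ∀ t, r + m < t → t ≤ N → F t = 0) :
    ∑ t ∈ range (N + 1), F t = ∑ i ∈ range (m + 1), F (r + i) := by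
  rw [Finset.range_eq_Ico, Finset.range_eq_Ico, Finset.sum_Ico_add F 0 (m + 1) r, zero_add]
  symm
  refine Finset.sum_subset (fun t ht => ?_) fun t ht ht' => ?_
  · simp only [mem_Ico] at ht ⊢
    omega
  · simp only [mem_Ico, not_and, not_lt] at ht ht'
    rcases lt_or_ge t r with h1 | h1
    · exact hlt t h1
    · exact hgt t (by have := ht' h1; omega) (by omega)

lemma two_mul_choose_two (i : ℕ) : 2 * (i.choose 2 : ℤ) = i * (i - 1) := by
  induction i with
  | zero => simp
  | succ i ih =>
    rw [Nat.choose_succ_succ' i 1, Nat.choose_one_right]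
    push_cast
    linear_combination ih

/-- Pascal's rule inside an alternating sum. -/
lemma sum_gaussBinom_succ (m : ℕ) (G : ℕ → RatFunc ℚ) :
    ∑ t ∈ range (m + 2), (-1) ^ t * q ^ t.choose 2 * gaussBinom (m + 1) t * G t =
      ∑ t ∈ range (m + 1), (-1) ^ t * q ^ t.choose 2 * gaussBinom m t * G t -
        q ^ m * ∑ t ∈ range (m + 1), (-1) ^ t * q ^ t.choose 2 * gaussBinom m t * G (t + 1) := by
  have h : ∀ t ∈ range (m + 1),
      (-1) ^ (t + 1) * q ^ (t + 1).choose 2 * gaussBinom (m + 1) (t + 1) * G (t + 1) =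
        (-1) ^ (t + 1) * q ^ (t + 1).choose 2 * gaussBinom m (t + 1) * G (t + 1) -
          q ^ m * ((-1) ^ t * q ^ t.choose 2 * gaussBinom m t * G (t + 1)) := by
    intro t ht
    have ht' : t ≤ m := by simpa [Nat.lt_succ_iff] using ht
    have e : q ^ m = q ^ t * q ^ (m - t) := by rw [← pow_add, Nat.add_sub_cancel' ht']
    rw [gaussBinom_succ_succ' ht', q_pow_choose_succ, e]
    ring
  rw [sum_range_succ', sum_congr rfl h, sum_sub_distrib, ← mul_sum, sum_range_succ,
    gaussBinom_of_lt (Nat.lt_succ_self m)]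
  conv_rhs => rw [sum_range_succ']
  simp only [gaussBinom_zero]
  ring

/-- Pascal's rule inside an alternating sum with an additional linear weight. -/
lemma sum_gaussBinom_succ_mul_pow (m : ℕ) (G : ℕ → RatFunc ℚ) :
    ∑ t ∈ range (m + 2),
        (-1) ^ t * q ^ t.choose 2 * q ^ (m + 1 - t) * gaussBinom (m + 1) t * G t =
      q ^ (m + 1) * ∑ t ∈ range (m + 1), (-1) ^ t * q ^ t.choose 2 * gaussBinom m t * G t -
        q ^ m * ∑ t ∈ range (m + 1), (-1) ^ t * q ^ t.choose 2 * gaussBinom m t * G (t + 1) := by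
  have h : ∀ t ∈ range (m + 1),
      (-1) ^ (t + 1) * q ^ (t + 1).choose 2 * q ^ (m + 1 - (t + 1)) *
          gaussBinom (m + 1) (t + 1) * G (t + 1) =
        q ^ (m + 1) * ((-1) ^ (t + 1) * q ^ (t + 1).choose 2 * gaussBinom m (t + 1) * G (t + 1)) -
          q ^ m * ((-1) ^ t * q ^ t.choose 2 * gaussBinom m t * G (t + 1)) := by
    intro t ht
    have ht' : t ≤ m := by simpa [Nat.lt_succ_iff] using ht
    have e : q ^ m = q ^ t * q ^ (m - t) := by rw [← pow_add, Nat.add_sub_cancel' ht']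
    rw [gaussBinom_succ_succ, q_pow_choose_succ, pow_succ q m, e, Nat.add_sub_add_right]
    ring
  rw [sum_range_succ', sum_congr rfl h, sum_sub_distrib, ← mul_sum, ← mul_sum, sum_range_succ,
    gaussBinom_of_lt (Nat.lt_succ_self m)]
  conv_rhs => rw [sum_range_succ']
  simp only [gaussBinom_zero, Nat.sub_zero]
  ring

/-- A form of the `q`-Chu–Vandermonde summation. -/
lemma sum_neg_one_pow_gaussBinom_mul {m d s : ℕ} (h : m ≤ s + d) :
    ∑ t ∈ range (m + 1), (-1) ^ t * q ^ t.choose 2 * gaussBinom m t * gaussBinom (s + d - t) s =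
      q ^ (m * d) * gaussBinom (s + d - m) d := by
  induction m generalizing d with
  | zero => simp [gaussBinom_zero, gaussBinom_symm s d]
  | succ m ih =>
    rw [sum_gaussBinom_succ m fun t => gaussBinom (s + d - t) s, ih (by omega)]
    rcases d with _ | d
    · rw [sum_eq_zero fun t _ => by rw [gaussBinom_of_lt (n := s + 0 - (t + 1)) (by omega)]; simp]
      simp [gaussBinom_zero]
    · have e : ∀ t, s + (d + 1) - (t + 1) = s + d - t := fun t => by omega
      simp only [e]
      rw [ih (by omega), show s + (d + 1) - m = s + d - m + 1 by omega, gaussBinom_succ_succ]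
      ring

/-- The contiguous case of the `q`-Chu–Vandermonde summation. -/
lemma sum_neg_one_pow_gaussBinom_mul_pow (m r : ℕ) :
    ∑ t ∈ range (m + 2), (-1) ^ t * q ^ t.choose 2 * q ^ (m + 1 - t) * gaussBinom (m + 1) t *
        gaussBinom (r + (m + 1) - t) r =
      q ^ ((m + 1) * (m + 1)) * gaussBinom (r + 1) (m + 1) - q ^ (m * (m + 1)) * gaussBinom r m := by
  rw [sum_gaussBinom_succ_mul_pow m fun t => gaussBinom (r + (m + 1) - t) r,
    sum_neg_one_pow_gaussBinom_mul (by omega)]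
  have e : ∀ t, r + (m + 1) - (t + 1) = r + m - t := fun t => by omega
  simp only [e]
  rw [sum_neg_one_pow_gaussBinom_mul (by omega), show r + (m + 1) - m = r + 1 by omega,
    show r + m - m = r by omega]
  ring

/-! ### The cyclic matrix without its weights -/

/-- The entries `(-1)^r q^{r(r-1)/2} [N - r, s]`. -/
noncomputable def alternatingEntry (N r s : ℕ) : RatFunc ℚ :=
  (-1) ^ r * q ^ r.choose 2 * gaussBinom (N - r) s

lemma sum_alternatingEntry_mul {N r s : ℕ} (hr : r ≤ N) (hs : s ≤ N) :
    ∑ t ∈ range (N + 1), alternatingEntry N r t * alternatingEntry N t s =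
      (-1) ^ r * q ^ r.choose 2 * (q ^ ((N - r) * (N - s)) * gaussBinom r (N - s)) := by
  rw [sum_range_eq_sum_shift (r := 0) (m := N - r) _ (by omega) (by omega)
    fun t ht _ => by rw [alternatingEntry, gaussBinom_of_lt (by omega)]; simp]
  have h := sum_neg_one_pow_gaussBinom_mul (m := N - r) (d := N - s) (s := s) (by omega)
  rw [show s + (N - s) = N by omega, show N - (N - r) = r by omega] at h
  rw [← h, mul_sum]
  refine sum_congr rfl fun t _ => ?_
  rw [alternatingEntry, alternatingEntry, zero_add]
  ring

lemma sum_sum_alternatingEntry_mul {N r : ℕ} (hr : r ≤ N) (u : ℕ) :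
    ∑ s ∈ range (N + 1),
        (∑ t ∈ range (N + 1), alternatingEntry N r t * alternatingEntry N t s) *
          alternatingEntry N s u =
      if r = u then (-1) ^ N * q ^ N.choose 2 else 0 := by
  rw [← sum_range_reflect]
  have h : ∀ i ∈ range (N + 1),
      (∑ t ∈ range (N + 1), alternatingEntry N r t * alternatingEntry N t (N + 1 - 1 - i)) *
          alternatingEntry N (N + 1 - 1 - i) u =
        (-1) ^ r * q ^ r.choose 2 * ((-1) ^ (N - i) * q ^ (N - i).choose 2 * q ^ ((N - r) * i)) *
          (gaussBinom r i * gaussBinom i u) := by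
    intro i hi
    have hi' : i ≤ N := by simpa [Nat.lt_succ_iff] using hi
    rw [Nat.add_sub_cancel, sum_alternatingEntry_mul hr (by omega), alternatingEntry,
      show N - (N - i) = i by omega]
    ring
  rw [sum_congr rfl h]
  rcases lt_or_ge r u with hru | hru
  · rw [if_neg (by omega)]
    refine sum_eq_zero fun i _ => ?_
    rcases lt_or_ge i u with hiu | hiu
    · rw [gaussBinom_of_lt hiu]; simp
    · rw [gaussBinom_of_lt (hru.trans_le hiu)]; simp
  · rw [sum_range_eq_sum_shift (r := u) (m := r - u) _ (by omega)
      (fun t ht => by rw [gaussBinom_of_lt ht]; simp)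
      fun t ht _ => by rw [gaussBinom_of_lt (n := r) (by omega)]; simp]
    have key : ∀ j ∈ range (r - u + 1),
        (-1) ^ r * q ^ r.choose 2 *
            ((-1) ^ (N - (u + j)) * q ^ (N - (u + j)).choose 2 * q ^ ((N - r) * (u + j))) *
            (gaussBinom r (u + j) * gaussBinom (u + j) u) =
          (-1) ^ r * q ^ r.choose 2 * (-1) ^ N * (-1) ^ u * gaussBinom r u *
            q ^ (N.choose 2 + u.choose 2 + u - r * u : ℤ) *
            (gaussBinom (r - u) j * q ^ j.choose 2 * (-q ^ (u + 1 - r : ℤ)) ^ j) := by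
      intro j hj
      have hj' : j ≤ r - u := by simpa [Nat.lt_succ_iff] using hj
      rw [gaussBinom_mul (by omega) (by omega), add_tsub_cancel_left]
      obtain ⟨a, ha⟩ : ∃ a, N = a + (u + j) := ⟨N - (u + j), by omega⟩
      obtain ⟨b, hb⟩ : ∃ b, N = b + r := ⟨N - r, by omega⟩
      have e1 : N - (u + j) = a := by omega
      have e2 : N - r = b := by omega
      rw [e1, e2, neg_pow]
      have es : (-1 : RatFunc ℚ) ^ N * (-1) ^ u * (-1) ^ j = (-1) ^ a := by
        rw [ha, pow_add, mul_assoc, mul_assoc, ← pow_add, ← pow_add, Even.neg_one_pow ⟨u + j, rfl⟩,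
          mul_one]
      have ep : q ^ a.choose 2 * q ^ (b * (u + j)) =
          q ^ (N.choose 2 + u.choose 2 + u - r * u : ℤ) * q ^ j.choose 2 *
            (q ^ (u + 1 - r : ℤ)) ^ j := by
        simp only [← zpow_natCast, ← zpow_mul, ← zpow_add₀ q_ne_zero]
        congr 1
        have h1 := two_mul_choose_two a
        have h2 := two_mul_choose_two N
        have h3 := two_mul_choose_two u
        have h4 := two_mul_choose_two j
        have ha' : (a : ℤ) = N - u - j := by omega
        have hb' : (b : ℤ) = N - r := by omega
        rw [ha'] at h1
        apply mul_left_cancel₀ (two_ne_zero (α := ℤ))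
        push_cast
        rw [hb']
        linear_combination h1 - h2 - h3 - h4
      rw [← es]
      linear_combination (-1) ^ r * q ^ r.choose 2 * (-1) ^ N * (-1) ^ u * (-1) ^ j *
        gaussBinom r u * gaussBinom (r - u) j * ep
    rw [sum_congr rfl key, ← mul_sum, sum_gaussBinom_mul_pow]
    rcases hru.eq_or_lt with rfl | hlt
    · have e : q ^ u.choose 2 * q ^ (N.choose 2 + u.choose 2 + u - u * u : ℤ) = q ^ N.choose 2 := by
        simp only [← zpow_natCast, ← zpow_add₀ q_ne_zero]
        congr 1
        linear_combination two_mul_choose_two u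
      have es : (-1 : RatFunc ℚ) ^ u * (-1) ^ u = 1 := by
        rw [← pow_add, Even.neg_one_pow ⟨u, rfl⟩]
      rw [if_pos rfl, gaussBinom_self, Nat.sub_self, prod_range_zero, ← e]
      linear_combination (-1) ^ N * q ^ u.choose 2 *
        q ^ (N.choose 2 + u.choose 2 + u - u * u : ℤ) * es
    · rw [if_neg (by omega), prod_eq_zero (i := r - u - 1) (by simp; omega), mul_zero]
      rw [← zpow_natCast, neg_mul, ← zpow_add₀ q_ne_zero,
        show (u + 1 - r : ℤ) + ((r - u - 1 : ℕ) : ℤ) = 0 by omega]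
      simp

/-! ### Moving the weights through the matrix -/

/-- The upper triangular matrix obtained by conjugating the weights from the left. -/
noncomputable def upperEntry (n r s : ℕ) : RatFunc ℚ :=
  if r ≤ s then
    (-q ^ (1 - n : ℤ)) ^ (s - r) * gaussBinom (2 * n - r) (s - r) * qPochZ (-q) (r - n)
  else 0

/-- The lower triangular matrix obtained by conjugating the weights from the right. -/
noncomputable def lowerEntry (n r s : ℕ) : RatFunc ℚ :=
  gaussBinom r s * q ^ (r - s).choose 2 * (q ^ (s - n + 1 : ℤ)) ^ (r - s) * qPochZ (-q) (s - n)

lemma qPochZ_mul_sum {n r s : ℕ} (h : r + s ≤ 2 * n) :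
    qPochZ (-q) (r - n) * ∑ i ∈ range (2 * n - r - s + 1),
        gaussBinom (2 * n - r - s) i * q ^ i.choose 2 * (q ^ (r - n + 1 : ℤ)) ^ i =
      qPochZ (-q) (n - s) := by
  rw [sum_gaussBinom_mul_pow, ← qPochZ_neg_q_add]
  congr 1
  omega

lemma sum_upperEntry_mul {n r s : ℕ} (hr : r ≤ 2 * n) :
    ∑ t ∈ range (2 * n + 1), upperEntry n r t * alternatingEntry (2 * n) t s =
      alternatingEntry (2 * n) r s * qPochZ (-q) (n - s) := by
  rcases lt_or_ge (2 * n) (r + s) with h | h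
  · rw [alternatingEntry, gaussBinom_of_lt (by omega), mul_zero, zero_mul]
    refine sum_eq_zero fun t _ => ?_
    rcases lt_or_ge t r with htr | htr
    · rw [upperEntry, if_neg (by omega), zero_mul]
    · rw [alternatingEntry, gaussBinom_of_lt (by omega), mul_zero, mul_zero]
  · rw [sum_range_eq_sum_shift (r := r) (m := 2 * n - r - s) _ (by omega)
      (fun t ht => by rw [upperEntry, if_neg (by omega), zero_mul])
      fun t ht _ => by rw [alternatingEntry, gaussBinom_of_lt (by omega), mul_zero, mul_zero],
      ← qPochZ_mul_sum h, mul_sum, mul_sum]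
    refine sum_congr rfl fun i hi => ?_
    have hi' : i ≤ 2 * n - r - s := by simpa [Nat.lt_succ_iff] using hi
    have hb := gaussBinom_mul_sub (n := 2 * n - r) (i := i) (s := s) (by omega)
    have ep : (-q ^ (1 - n : ℤ)) ^ i * ((-1) ^ (r + i) * q ^ (r + i).choose 2) =
        (-1) ^ r * q ^ r.choose 2 * (q ^ i.choose 2 * (q ^ (r - n + 1 : ℤ)) ^ i) := by
      have e : (q ^ (1 - n : ℤ)) ^ i * q ^ (r + i).choose 2 =
          q ^ r.choose 2 * (q ^ i.choose 2 * (q ^ (r - n + 1 : ℤ)) ^ i) := by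
        simp only [← zpow_natCast, ← zpow_mul, ← zpow_add₀ q_ne_zero]
        congr 1
        have h1 := two_mul_choose_two (r + i)
        have h2 := two_mul_choose_two r
        have h3 := two_mul_choose_two i
        apply mul_left_cancel₀ (two_ne_zero (α := ℤ))
        push_cast at h1 ⊢
        linear_combination h1 - h2 - h3
      have es : (-1 : RatFunc ℚ) ^ i * (-1) ^ i = 1 := by
        rw [← pow_add, Even.neg_one_pow ⟨i, rfl⟩]
      rw [neg_pow, pow_add (-1 : RatFunc ℚ) r i]
      linear_combination (-1) ^ r * (q ^ (1 - n : ℤ)) ^ i * q ^ (r + i).choose 2 * es +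
        (-1) ^ r * e
    rw [upperEntry, if_pos (by omega), alternatingEntry, alternatingEntry, add_tsub_cancel_left,
      ← Nat.sub_sub]
    linear_combination (gaussBinom (2 * n - r) i * gaussBinom (2 * n - r - i) s) *
      qPochZ (-q) (r - n) * ep + (-1) ^ r * q ^ r.choose 2 *
        (q ^ i.choose 2 * (q ^ (r - n + 1 : ℤ)) ^ i) * qPochZ (-q) (r - n) * hb

lemma sum_mul_lowerEntry {n r s : ℕ} (hr : r ≤ 2 * n) :
    ∑ t ∈ range (2 * n + 1), alternatingEntry (2 * n) r t * lowerEntry n t s =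
      qPochZ (-q) (n - r) * alternatingEntry (2 * n) r s := by
  rcases lt_or_ge (2 * n) (r + s) with h | h
  · rw [alternatingEntry, gaussBinom_of_lt (by omega), mul_zero, mul_zero]
    refine sum_eq_zero fun t _ => ?_
    rcases lt_or_ge t s with hts | hts
    · rw [lowerEntry, gaussBinom_of_lt hts]; simp
    · rw [alternatingEntry, gaussBinom_of_lt (by omega), mul_zero, zero_mul]
  · have hw := qPochZ_mul_sum (n := n) (r := s) (s := r) (by omega)
    rw [sum_range_eq_sum_shift (r := s) (m := 2 * n - s - r) _ (by omega)
      (fun t ht => by rw [lowerEntry, gaussBinom_of_lt ht]; simp)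
      fun t ht _ => by rw [alternatingEntry, gaussBinom_of_lt (by omega), mul_zero, zero_mul],
      ← hw, mul_sum, sum_mul]
    refine sum_congr rfl fun i hi => ?_
    have hi' : i ≤ 2 * n - s - r := by simpa [Nat.lt_succ_iff] using hi
    have hb := gaussBinom_mul (n := 2 * n - r) (k := s + i) (s := s) (by omega) (by omega)
    rw [add_tsub_cancel_left, Nat.sub_right_comm] at hb
    rw [lowerEntry, alternatingEntry, alternatingEntry, add_tsub_cancel_left]
    linear_combination (-1) ^ r * q ^ r.choose 2 * q ^ i.choose 2 * (q ^ (s - n + 1 : ℤ)) ^ i *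
      qPochZ (-q) (s - n) * hb

/-! ### Reduction to a single sum -/

lemma Wmul_three (n : ℕ) :
    Wmul 3 n = ∑ a ∈ range (2 * n + 1), ∑ b ∈ range (2 * n + 1), ∑ c ∈ range (2 * n + 1),
      (qPochZ (-q) (n - a) * alternatingEntry (2 * n) a b) *
        (qPochZ (-q) (n - b) * alternatingEntry (2 * n) b c) *
        (qPochZ (-q) (n - c) * alternatingEntry (2 * n) c a) := by
  have hterm : ∀ a ∈ range (2 * n + 1), ∀ b : ℕ,
      (-1 : RatFunc ℚ) ^ a * q ^ (a * (a - 1) / 2) * qPochZ (-q) ((n : ℤ) - a) *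
        qbinom (2 * (n : ℤ) - a) b = qPochZ (-q) (n - a) * alternatingEntry (2 * n) a b := by
    intro a ha b
    have ha' : a ≤ 2 * n := by simpa [Nat.lt_succ_iff] using ha
    rw [show 2 * (n : ℤ) - a = ((2 * n - a : ℕ) : ℤ) by omega, qbinom_natCast, alternatingEntry,
      Nat.choose_two_right]
    ring
  rw [Wmul]
  simp only [← sum_product']
  refine sum_bij' (fun r _ => (r 0, r 1, r 2)) (fun p _ => ![p.1, p.2.1, p.2.2]) ?_ ?_ ?_ ?_ ?_
  · intro r hr
    simp only [Fintype.mem_piFinset] at hr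
    simp only [mem_product]
    exact ⟨hr 0, hr 1, hr 2⟩
  · intro p hp
    simp only [mem_product] at hp
    simp only [Fintype.mem_piFinset]
    intro i
    fin_cases i
    · exact hp.1
    · exact hp.2.1
    · exact hp.2.2
  · intro r _
    ext i
    fin_cases i <;> rfl
  · intro p _
    rfl
  · intro r hr
    simp only [Fintype.mem_piFinset] at hr
    rw [Fin.prod_univ_three, hterm _ (hr 0), hterm _ (hr 1), hterm _ (hr 2)]
    rfl

lemma Wmul_three_eq_sum_sum (n : ℕ) :
    Wmul 3 n = q ^ (2 * n).choose 2 * ∑ a ∈ range (2 * n + 1), qPochZ (-q) (n - a) *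
      ∑ b ∈ range (2 * n + 1), upperEntry n a b * lowerEntry n b a := by
  let A : Matrix (Fin (2 * n + 1)) (Fin (2 * n + 1)) (RatFunc ℚ) :=
    .of fun r s => alternatingEntry (2 * n) r s
  let D : Matrix (Fin (2 * n + 1)) (Fin (2 * n + 1)) (RatFunc ℚ) :=
    .diagonal fun r => qPochZ (-q) (n - (r : ℕ))
  let Y : Matrix (Fin (2 * n + 1)) (Fin (2 * n + 1)) (RatFunc ℚ) :=
    .of fun r s => upperEntry n r s
  let Z : Matrix (Fin (2 * n + 1)) (Fin (2 * n + 1)) (RatFunc ℚ) :=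
    .of fun r s => lowerEntry n r s
  have hA : A * A * A = q ^ (2 * n).choose 2 • (1 : Matrix _ _ _) := by
    ext r u
    have h := sum_sum_alternatingEntry_mul (N := 2 * n) (r := r) (by omega) u
    simp only [sum_range] at h
    simp only [Matrix.mul_apply, A, Matrix.of_apply, h, Matrix.smul_apply, Matrix.one_apply,
      Fin.ext_iff, smul_eq_mul]
    simp
  have hY : A * D = Y * A := by
    ext r s
    have h := sum_upperEntry_mul (n := n) (r := r) (s := s) (by omega)
    rw [sum_range] at h
    rw [Matrix.mul_diagonal, Matrix.mul_apply]
    exact h.symm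
  have hZ : D * A = A * Z := by
    ext r s
    have h := sum_mul_lowerEntry (n := n) (r := r) (s := s) (by omega)
    rw [sum_range] at h
    rw [Matrix.diagonal_mul, Matrix.mul_apply]
    exact h.symm
  have hprod : D * A * (D * A * (D * A)) = q ^ (2 * n).choose 2 • (D * (Y * Z)) := by
    calc D * A * (D * A * (D * A)) = D * (A * D) * A * (D * A) := by simp only [mul_assoc]
      _ = D * Y * (A * A * A) * Z := by rw [hY, hZ]; simp only [mul_assoc]
      _ = _ := by rw [hA]; simp only [Matrix.mul_smul, Matrix.smul_mul, mul_one, mul_assoc]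
  have hD (X : Matrix (Fin (2 * n + 1)) (Fin (2 * n + 1)) (RatFunc ℚ)) (r s) :
      (D * X) r s = qPochZ (-q) (n - (r : ℕ)) * X r s := Matrix.diagonal_mul _ _ _ _
  have htr := congrArg Matrix.trace hprod
  rw [Matrix.trace_smul, smul_eq_mul] at htr
  rw [Wmul_three]
  simp only [sum_range]
  convert htr using 1
  · refine Fintype.sum_congr _ _ fun a => ?_
    simp only [Matrix.diag_apply, Matrix.mul_apply (M := D * A), mul_sum, hD]
    exact sum_congr rfl fun b _ => sum_congr rfl fun c _ => mul_assoc _ _ _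
  · congr 1
    refine Fintype.sum_congr _ _ fun a => ?_
    rw [Matrix.diag_apply, hD, Matrix.mul_apply]
    rfl

lemma sum_upperEntry_mul_lowerEntry {n r : ℕ} (hr : r ≤ 2 * n) :
    q ^ (2 * n - r).choose 2 *
        ∑ b ∈ range (2 * n + 1), upperEntry n r b * lowerEntry n b r =
      (-1) ^ (2 * n - r) * qPochZ (-q) (r - n) ^ 2 *
        ∑ t ∈ range (2 * n - r + 1), (-1) ^ t * q ^ t.choose 2 * q ^ (2 * n - r - t) *
          gaussBinom (2 * n - r) t * gaussBinom (r + (2 * n - r) - t) r := by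
  rw [sum_range_eq_sum_shift (r := r) (m := 2 * n - r) _ (by omega)
    (fun t ht => by rw [lowerEntry, gaussBinom_of_lt ht]; simp) (by omega), ← sum_range_reflect,
    mul_sum, mul_sum]
  obtain ⟨M, hM⟩ : ∃ M, M = 2 * n - r := ⟨_, rfl⟩
  rw [← hM]
  refine sum_congr rfl fun t ht => ?_
  have ht' : t ≤ M := by simpa [Nat.lt_succ_iff] using ht
  obtain ⟨i, rfl⟩ := Nat.exists_eq_add_of_le' ht'
  rw [show i + t + 1 - 1 - t = i by omega, upperEntry, if_pos (by omega), lowerEntry,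
    add_tsub_cancel_left, ← hM, show i + t - t = i by omega, show r + (i + t) - t = r + i by omega,
    gaussBinom_symm i t, neg_pow]
  have ep : q ^ (i + t).choose 2 * (q ^ (1 - n : ℤ)) ^ i * q ^ i.choose 2 *
      (q ^ (r - n + 1 : ℤ)) ^ i = q ^ t.choose 2 * q ^ i := by
    simp only [← zpow_natCast, ← zpow_mul, ← zpow_add₀ q_ne_zero]
    congr 1
    have h1 := two_mul_choose_two (i + t)
    have h2 := two_mul_choose_two t
    have h3 := two_mul_choose_two i
    have hr' : (r : ℤ) = 2 * n - i - t := by omega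
    apply mul_left_cancel₀ (two_ne_zero (α := ℤ))
    push_cast at h1 ⊢
    rw [hr']
    linear_combination h1 - h2 + h3
  have es : (-1 : RatFunc ℚ) ^ t * (-1) ^ t = 1 := by
    rw [← pow_add, Even.neg_one_pow ⟨t, rfl⟩]
  rw [pow_add (-1 : RatFunc ℚ) i t]
  linear_combination (-1) ^ i * gaussBinom (i + t) t * gaussBinom (r + i) r *
    qPochZ (-q) (r - n) ^ 2 * (ep - q ^ t.choose 2 * q ^ i * es)

lemma sum_upperEntry_mul_lowerEntry_of_lt {n r : ℕ} (hr : r < n) :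
    ∑ b ∈ range (2 * n + 1), upperEntry n r b * lowerEntry n b r = 0 := by
  have h := sum_upperEntry_mul_lowerEntry (n := n) (r := r) (by omega)
  obtain ⟨m, hm⟩ : ∃ m, 2 * n - r = m + 1 := ⟨2 * n - r - 1, by omega⟩
  rw [hm, sum_neg_one_pow_gaussBinom_mul_pow, gaussBinom_of_lt (by omega),
    gaussBinom_of_lt (by omega)] at h
  simpa [q_ne_zero] using h

lemma sum_upperEntry_mul_lowerEntry_add (M m : ℕ) :
    ∑ b ∈ range (2 * (M + m) + 1),
        upperEntry (M + m) (M + m + m) b * lowerEntry (M + m) b (M + m + m) =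
      (-1) ^ M * qPoch (-q) m ^ 2 * q ^ (M + 1).choose 2 *
        (gaussBinom (M + m + m + 1) (2 * m + 1) -
          q ^ (-M : ℤ) * gaussBinom (M + m + m) (2 * m + 1)) := by
  have h := sum_upperEntry_mul_lowerEntry (n := M + m) (r := M + m + m) (by omega)
  rw [show 2 * (M + m) - (M + m + m) = M by omega] at h
  have hz : qPochZ (-q) (((M + m + m : ℕ) : ℤ) - ((M + m : ℕ) : ℤ)) = qPoch (-q) m := by
    rw [← qPochZ_neg_q_natCast]
    congr 1
    push_cast
    ring
  rw [hz] at h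
  apply mul_left_cancel₀ (pow_ne_zero (M.choose 2) q_ne_zero)
  rw [h]
  rcases M with _ | M
  · simp [two_mul, gaussBinom_self, gaussBinom_of_lt]
  · rw [sum_neg_one_pow_gaussBinom_mul_pow,
      show M + 1 + m + m + 1 = (M + 1) + (2 * m + 1) by ring, gaussBinom_symm,
      show M + 1 + m + m = M + (2 * m + 1) by ring, gaussBinom_symm]
    have e1 : q ^ ((M + 1) * (M + 1)) = q ^ (M + 1).choose 2 * q ^ (M + 1 + 1).choose 2 := by
      rw [← pow_add]
      congr 1
      zify
      apply mul_left_cancel₀ (two_ne_zero (α := ℤ))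
      have h1 := two_mul_choose_two (M + 1)
      have h2 := two_mul_choose_two (M + 1 + 1)
      push_cast at h1 h2 ⊢
      linear_combination -h1 - h2
    have e2 : q ^ (M * (M + 1)) = q ^ ((M + 1) * (M + 1)) * q ^ (-(M + 1 : ℕ) : ℤ) := by
      simp only [← zpow_natCast, ← zpow_add₀ q_ne_zero]
      congr 1
      push_cast
      ring
    rw [e2, e1]
    ring

/-! ### Evaluation of the single sums -/

/-- The weight of the `m`-th summand in the single sums. -/
noncomputable def weight (n m : ℕ) : RatFunc ℚ :=
  (-1) ^ m * qPoch (-q) m * q ^ ((m : ℤ) ^ 2 - m - n * m)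

lemma weight_zero (n : ℕ) : weight n 0 = 1 := by simp [weight, qPoch_zero]

lemma weight_succ_mul (n m : ℕ) : weight (n + 1) m * q ^ m = weight n m := by
  rw [weight, weight, mul_assoc, ← zpow_natCast q m, ← zpow_add₀ q_ne_zero]
  congr 2
  push_cast
  ring

lemma weight_succ_succ_mul (n m : ℕ) :
    weight (n + 1) (m + 1) * q ^ (n + 1) = -(weight n m * ((1 + q ^ (m + 1)) * q ^ m)) := by
  have e : q ^ (((m + 1 : ℕ) : ℤ) ^ 2 - (m + 1 : ℕ) - (n + 1 : ℕ) * (m + 1 : ℕ)) * q ^ (n + 1) =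
      q ^ ((m : ℤ) ^ 2 - m - n * m) * q ^ m := by
    simp only [← zpow_natCast, ← zpow_add₀ q_ne_zero]
    congr 1
    push_cast
    ring
  rw [weight, weight, qPoch_succ]
  linear_combination (-1) ^ (m + 1) * (qPoch (-q) m * (1 - -q * q ^ m)) * e

/-- The single sum over `[n + m + 1, 2m + 1]`. -/
noncomputable def oddSum (e n : ℕ) : RatFunc ℚ :=
  ∑ m ∈ range (n + 1), weight n m * q ^ (e * m) * gaussBinom (n + m + 1) (2 * m + 1)

/-- The single sum over `[n + m, 2m]`. -/
noncomputable def evenSum (e n : ℕ) : RatFunc ℚ :=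
  ∑ m ∈ range (n + 1), weight n m * q ^ (e * m) * gaussBinom (n + m) (2 * m)

lemma oddSum_eq_sum_range_succ (e n : ℕ) :
    oddSum e n =
      ∑ m ∈ range (n + 2), weight n m * q ^ (e * m) * gaussBinom (n + m + 1) (2 * m + 1) := by
  rw [sum_range_succ _ (n + 1), gaussBinom_of_lt (by omega), mul_zero, add_zero, oddSum]

lemma oddSum_succ (e n : ℕ) :
    oddSum e (n + 1) = q * oddSum (e + 1) n + evenSum e (n + 1) := by
  rw [oddSum, evenSum, oddSum_eq_sum_range_succ, mul_sum, ← sum_add_distrib]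
  refine sum_congr rfl fun m _ => ?_
  rw [gaussBinom_succ_succ, ← weight_succ_mul n m, add_right_comm n 1 m]
  ring

lemma oddSum_one_succ (n : ℕ) :
    oddSum 1 (n + 1) = oddSum 0 n + q ^ (n + 1) * evenSum 0 (n + 1) := by
  rw [oddSum, evenSum, oddSum_eq_sum_range_succ, mul_sum, ← sum_add_distrib]
  refine sum_congr rfl fun m hm => ?_
  have hm' : m ≤ n + 1 := by simpa [Nat.lt_succ_iff] using hm
  have e : q ^ (n + 1) = q ^ (n + 1 + m - 2 * m) * q ^ m := by
    rw [← pow_add]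
    congr 1
    omega
  rw [gaussBinom_succ_succ' (by omega), ← weight_succ_mul n m, add_right_comm n 1 m, e,
    add_right_comm n 1 m]
  ring

lemma evenSum_one_succ (n : ℕ) :
    evenSum 1 (n + 1) = evenSum 0 n - (oddSum 1 n + q * oddSum 2 n) := by
  have h : ∀ m ∈ range (n + 1),
      weight (n + 1) (m + 1) * q ^ (1 * (m + 1)) * gaussBinom (n + 1 + (m + 1)) (2 * (m + 1)) =
        weight n (m + 1) * q ^ (0 * (m + 1)) * gaussBinom (n + (m + 1)) (2 * (m + 1)) -
        (weight n m * q ^ (1 * m) * gaussBinom (n + m + 1) (2 * m + 1) +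
          q * (weight n m * q ^ (2 * m) * gaussBinom (n + m + 1) (2 * m + 1))) := by
    intro m hm
    have hm' : m ≤ n := by simpa [Nat.lt_succ_iff] using hm
    have e : q ^ (n + 1) = q ^ (n + m + 1 - (2 * m + 1)) * q ^ (m + 1) := by
      rw [← pow_add]
      congr 1
      omega
    have hw := weight_succ_succ_mul n m
    rw [e] at hw
    rw [show n + 1 + (m + 1) = n + m + 1 + 1 by ring, show 2 * (m + 1) = 2 * m + 1 + 1 by ring,
      gaussBinom_succ_succ' (by omega), ← weight_succ_mul n (m + 1), ← add_assoc n m 1]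
    linear_combination gaussBinom (n + m + 1) (2 * m + 1) * hw
  have h0 : evenSum 0 n =
      ∑ m ∈ range (n + 2), weight n m * q ^ (0 * m) * gaussBinom (n + m) (2 * m) := by
    rw [sum_range_succ _ (n + 1), gaussBinom_of_lt (by omega), mul_zero, add_zero, evenSum]
  rw [h0, evenSum, oddSum, oddSum, sum_range_succ', sum_congr rfl h, sum_sub_distrib,
    sum_add_distrib, ← mul_sum]
  conv_rhs => rw [sum_range_succ']
  simp only [weight_zero, mul_zero, gaussBinom_zero]
  ring

lemma oddSum_one_succ_add (n : ℕ) : oddSum 1 (n + 1) = evenSum 0 n - oddSum 1 n := by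
  linear_combination oddSum_succ 1 n + evenSum_one_succ n

lemma pow_mul_evenSum_zero_succ (n : ℕ) :
    q ^ (n + 1) * evenSum 0 (n + 1) = oddSum 1 (n + 1) - oddSum 0 n := by
  rw [oddSum_one_succ]
  ring

lemma oddSum_one_two_mul_add_one {k : ℕ} (h1 : oddSum 1 (2 * k) = (-1) ^ k * q ^ (-(k : ℤ) ^ 2))
    (h2 : evenSum 0 (2 * k) = (-1) ^ k * q ^ (-(k : ℤ) ^ 2)) : oddSum 1 (2 * k + 1) = 0 := by
  rw [oddSum_one_succ_add, h1, h2, sub_self]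

lemma evenSum_zero_two_mul_add_one {k : ℕ} (h0 : oddSum 0 (2 * k) = (-1) ^ k * q ^ (-(k : ℤ) ^ 2))
    (h1 : oddSum 1 (2 * k + 1) = 0) :
    evenSum 0 (2 * k + 1) = (-1) ^ (k + 1) * q ^ (-((k + 1 : ℕ) : ℤ) ^ 2) := by
  apply mul_left_cancel₀ (pow_ne_zero (2 * k + 1) q_ne_zero)
  have e : q ^ (2 * k + 1) * q ^ (-((k + 1 : ℕ) : ℤ) ^ 2) = q ^ (-(k : ℤ) ^ 2) := by
    rw [← zpow_natCast q, ← zpow_add₀ q_ne_zero]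
    congr 1
    push_cast
    ring
  rw [pow_mul_evenSum_zero_succ, h0, h1]
  linear_combination -(-1) ^ (k + 1) * e

lemma singleSums_two_mul (k : ℕ) :
    oddSum 0 (2 * k) = (-1) ^ k * q ^ (-(k : ℤ) ^ 2) ∧
      oddSum 1 (2 * k) = (-1) ^ k * q ^ (-(k : ℤ) ^ 2) ∧
      evenSum 0 (2 * k) = (-1) ^ k * q ^ (-(k : ℤ) ^ 2) := by
  induction k with
  | zero => simp [oddSum, evenSum, weight_zero, gaussBinom_self]
  | succ k ih =>
    obtain ⟨h0, h1, h2⟩ := ih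
    have i1 := oddSum_one_two_mul_add_one h1 h2
    have i2 := evenSum_zero_two_mul_add_one h0 i1
    have i0 := oddSum_succ 0 (2 * k)
    rw [zero_add, h1, i2] at i0
    have j1 := oddSum_one_succ_add (2 * k + 1)
    rw [i1, i2, sub_zero] at j1
    have j2 := pow_mul_evenSum_zero_succ (2 * k + 1)
    rw [i0, j1] at j2
    have e : q ^ (2 * k + 1 + 1) * q ^ (-((k + 1 : ℕ) : ℤ) ^ 2) = q * q ^ (-(k : ℤ) ^ 2) := by
      rw [← zpow_natCast q, ← zpow_add₀ q_ne_zero, ← zpow_one_add₀ q_ne_zero]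
      congr 1
      push_cast
      ring
    have j2' : evenSum 0 (2 * k + 1 + 1) = (-1) ^ (k + 1) * q ^ (-((k + 1 : ℕ) : ℤ) ^ 2) := by
      apply mul_left_cancel₀ (pow_ne_zero (2 * k + 1 + 1) q_ne_zero)
      linear_combination j2 - (-1) ^ (k + 1) * e
    have j0 := oddSum_succ 0 (2 * k + 1)
    rw [zero_add, i1, mul_zero, zero_add, j2'] at j0
    exact ⟨j0, j1, j2'⟩

lemma oddSum_zero_two_mul_add_one (k : ℕ) :
    oddSum 0 (2 * k + 1) =
      (-1) ^ k * (q * q ^ (-(k : ℤ) ^ 2) - q ^ (-((k + 1 : ℕ) : ℤ) ^ 2)) := by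
  obtain ⟨h0, h1, h2⟩ := singleSums_two_mul k
  rw [oddSum_succ, zero_add, h1,
    evenSum_zero_two_mul_add_one h0 (oddSum_one_two_mul_add_one h1 h2)]
  ring

/-! ### The triple sum -/

lemma two_mul_weighted_sum_upperEntry_mul_lowerEntry {n m : ℕ} (hm : m ≤ n + 1) :
    2 * (qPochZ (-q) ((n + 1 : ℕ) - (n + 1 + m : ℕ)) * ∑ b ∈ range (2 * (n + 1) + 1),
        upperEntry (n + 1) (n + 1 + m) b * lowerEntry (n + 1) b (n + 1 + m)) =
      (-1) ^ (n + 1) * q ^ (n + 1 + 1).choose 2 *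
        (weight (n + 1) m * (1 + q ^ m) * gaussBinom (n + 1 + m + 1) (2 * m + 1) -
          q ^ (-(n + 1 : ℕ) : ℤ) *
            (weight n m * (1 + q ^ m) * gaussBinom (n + m + 1) (2 * m + 1))) := by
  rw [← weight_succ_mul n m, add_right_comm n m 1]
  obtain ⟨M, hM⟩ := Nat.exists_eq_add_of_le' hm
  rw [hM, sum_upperEntry_mul_lowerEntry_add,
    show ((M + m : ℕ) : ℤ) - (M + m + m : ℕ) = -m by push_cast; ring]
  have hv := qPochZ_neg_q_mul_neg m
  rw [qPochZ_neg_q_natCast] at hv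
  have es : (-1 : RatFunc ℚ) ^ m * (-1) ^ m = 1 := by
    rw [← pow_add, Even.neg_one_pow ⟨m, rfl⟩]
  have ep : q ^ (M + m + 1).choose 2 * q ^ ((m : ℤ) ^ 2 - m - (M + m : ℕ) * m) =
      q ^ m.choose 2 * q ^ (M + 1).choose 2 := by
    simp only [← zpow_natCast, ← zpow_add₀ q_ne_zero]
    congr 1
    have h1 := two_mul_choose_two (M + m + 1)
    have h2 := two_mul_choose_two m
    have h3 := two_mul_choose_two (M + 1)
    apply mul_left_cancel₀ (two_ne_zero (α := ℤ))
    push_cast at h1 h3 ⊢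
    linear_combination h1 - h2 - h3
  have eN : q ^ (-(M + m : ℕ) : ℤ) * q ^ m = q ^ (-M : ℤ) := by
    rw [← zpow_natCast q m, ← zpow_add₀ q_ne_zero]
    congr 1
    push_cast
    ring
  rw [weight, pow_add (-1 : RatFunc ℚ) M m, ← eN]
  set G := gaussBinom (M + m + m + 1) (2 * m + 1) -
    q ^ (-(M + m : ℕ) : ℤ) * q ^ m * gaussBinom (M + m + m) (2 * m + 1) with hG
  linear_combination (-1) ^ M * qPoch (-q) m * q ^ (M + 1).choose 2 * G * hv -
    (-1) ^ M * qPoch (-q) m * (1 + q ^ m) * G * ep -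
    (-1) ^ M * qPoch (-q) m * (1 + q ^ m) * G * q ^ (M + m + 1).choose 2 *
      q ^ ((m : ℤ) ^ 2 - m - (M + m : ℕ) * m) * es

lemma sum_weight_mul_one_add_pow (n : ℕ) :
    ∑ m ∈ range (n + 1), weight n m * (1 + q ^ m) * gaussBinom (n + m + 1) (2 * m + 1) =
      oddSum 0 n + oddSum 1 n := by
  rw [oddSum, oddSum, ← sum_add_distrib]
  refine sum_congr rfl fun m _ => ?_
  ring

lemma two_mul_Wmul_three_succ (n : ℕ) :
    2 * Wmul 3 (n + 1) =
      (-1) ^ (n + 1) * q ^ ((2 * (n + 1)).choose 2 + (n + 1 + 1).choose 2) *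
        (oddSum 0 (n + 1) + oddSum 1 (n + 1) -
          q ^ (-(n + 1 : ℕ) : ℤ) * (oddSum 0 n + oddSum 1 n)) := by
  have hn : oddSum 0 n + oddSum 1 n = ∑ m ∈ range (n + 1 + 1),
      weight n m * (1 + q ^ m) * gaussBinom (n + m + 1) (2 * m + 1) := by
    rw [sum_range_succ, gaussBinom_of_lt (by omega), mul_zero, add_zero,
      sum_weight_mul_one_add_pow]
  rw [Wmul_three_eq_sum_sum, sum_range_eq_sum_shift (r := n + 1) (m := n + 1) _ (by omega)
      (fun t ht => by rw [sum_upperEntry_mul_lowerEntry_of_lt ht, mul_zero]) (by omega),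
    mul_left_comm, mul_sum,
    sum_congr rfl fun m hm => two_mul_weighted_sum_upperEntry_mul_lowerEntry
      (by simpa [Nat.lt_succ_iff] using hm),
    ← mul_sum, sum_sub_distrib, ← mul_sum, sum_weight_mul_one_add_pow, ← hn, pow_add q]
  ring

lemma two_mul_Wmul_three_two_mul_add_one (j : ℕ) :
    2 * Wmul 3 (2 * j + 1) = (-1) ^ (j + 1) *
      (q ^ (9 * (j : ℤ) ^ 2 + 9 * j + 3) - 3 * q ^ (9 * (j : ℤ) ^ 2 + 7 * j + 1)) := by
  obtain ⟨h0, h1, h2⟩ := singleSums_two_mul j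
  rw [two_mul_Wmul_three_succ, oddSum_zero_two_mul_add_one, oddSum_one_two_mul_add_one h1 h2,
    h0, h1, Odd.neg_one_pow ⟨j, rfl⟩]
  have c1 := two_mul_choose_two (2 * (2 * j + 1))
  have c2 := two_mul_choose_two (2 * j + 1 + 1)
  push_cast at c1 c2
  have e1 : q ^ ((2 * (2 * j + 1)).choose 2 + (2 * j + 1 + 1).choose 2) *
      (q * q ^ (-(j : ℤ) ^ 2)) = q ^ (9 * (j : ℤ) ^ 2 + 9 * j + 3) := by
    rw [← zpow_natCast q, ← zpow_one_add₀ q_ne_zero, ← zpow_add₀ q_ne_zero]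
    congr 1
    push_cast
    linarith
  have e2 : q ^ ((2 * (2 * j + 1)).choose 2 + (2 * j + 1 + 1).choose 2) *
      q ^ (-((j + 1 : ℕ) : ℤ) ^ 2) = q ^ (9 * (j : ℤ) ^ 2 + 7 * j + 1) := by
    rw [← zpow_natCast q, ← zpow_add₀ q_ne_zero]
    congr 1
    push_cast
    linarith
  have e3 : q ^ (-(2 * j + 1 : ℕ) : ℤ) * q ^ (-(j : ℤ) ^ 2) = q ^ (-((j + 1 : ℕ) : ℤ) ^ 2) := by
    rw [← zpow_add₀ q_ne_zero]
    congr 1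
    push_cast
    ring
  rw [← e1, ← e2, ← e3]
  ring

lemma two_mul_Wmul_three_two_mul (j : ℕ) :
    2 * Wmul 3 (2 * j + 1 + 1) = (-1) ^ j *
      (q ^ (9 * ((j + 1 : ℕ) : ℤ) ^ 2 - 3 * (j + 1 : ℕ)) -
        3 * q ^ (9 * ((j + 1 : ℕ) : ℤ) ^ 2 - (j + 1 : ℕ))) := by
  obtain ⟨h0, h1, h2⟩ := singleSums_two_mul j
  obtain ⟨i0, i1, -⟩ := singleSums_two_mul (j + 1)
  rw [two_mul_Wmul_three_succ, oddSum_zero_two_mul_add_one, oddSum_one_two_mul_add_one h1 h2,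
    show 2 * j + 1 + 1 = 2 * (j + 1) by ring, i0, i1, Even.neg_one_pow ⟨j + 1, two_mul _⟩]
  have c1 := two_mul_choose_two (2 * (2 * (j + 1)))
  have c2 := two_mul_choose_two (2 * (j + 1) + 1)
  push_cast at c1 c2
  have e1 : q ^ ((2 * (2 * (j + 1))).choose 2 + (2 * (j + 1) + 1).choose 2) *
      (q ^ (-(2 * (j + 1) : ℕ) : ℤ) * q ^ (-((j + 1 : ℕ) : ℤ) ^ 2)) =
        q ^ (9 * ((j + 1 : ℕ) : ℤ) ^ 2 - 3 * (j + 1 : ℕ)) := by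
    rw [← zpow_natCast q, ← zpow_add₀ q_ne_zero, ← zpow_add₀ q_ne_zero]
    congr 1
    push_cast
    linarith
  have e2 : q ^ ((2 * (2 * (j + 1))).choose 2 + (2 * (j + 1) + 1).choose 2) *
      q ^ (-((j + 1 : ℕ) : ℤ) ^ 2) = q ^ (9 * ((j + 1 : ℕ) : ℤ) ^ 2 - (j + 1 : ℕ)) := by
    rw [← zpow_natCast q, ← zpow_add₀ q_ne_zero]
    congr 1
    push_cast
    linarith
  have e3 : q ^ (-(2 * (j + 1) : ℕ) : ℤ) * (q * q ^ (-(j : ℤ) ^ 2)) =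
      q ^ (-((j + 1 : ℕ) : ℤ) ^ 2) := by
    rw [← zpow_one_add₀ q_ne_zero, ← zpow_add₀ q_ne_zero]
    congr 1
    push_cast
    ring
  rw [← e1, ← e2]
  linear_combination -(-1) ^ j *
    q ^ ((2 * (2 * (j + 1))).choose 2 + (2 * (j + 1) + 1).choose 2) * e3

/-- Theorem 3.1 (fourth part): the evaluation of `W_3(n)`. -/
theorem W3_eval (n : ℕ) (hn : 1 ≤ n) (k : ℕ) :
    ((n : ℤ) = 2 * k - 1 →
      Wmul 3 n = (-1 : RatFunc ℚ) ^ k / 2 *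
        (q ^ (9 * (k : ℤ) ^ 2 - 9 * k + 3) - 3 * q ^ (9 * (k : ℤ) ^ 2 - 11 * k + 3))) ∧
    ((n : ℤ) = 2 * k →
      Wmul 3 n = (-1 : RatFunc ℚ) ^ ((k : ℤ) - 1) / 2 *
        (q ^ (9 * (k : ℤ) ^ 2 - 3 * k) - 3 * q ^ (9 * (k : ℤ) ^ 2 - k))) := by
  refine ⟨fun h => ?_, fun h => ?_⟩
  · obtain ⟨j, rfl⟩ : ∃ j, k = j + 1 := ⟨k - 1, by omega⟩
    obtain rfl : n = 2 * j + 1 := by omega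
    have e1 : 9 * ((j + 1 : ℕ) : ℤ) ^ 2 - 9 * (j + 1 : ℕ) + 3 = 9 * (j : ℤ) ^ 2 + 9 * j + 3 := by
      push_cast
      ring
    have e2 : 9 * ((j + 1 : ℕ) : ℤ) ^ 2 - 11 * (j + 1 : ℕ) + 3 =
        9 * (j : ℤ) ^ 2 + 7 * j + 1 := by
      push_cast
      ring
    rw [e1, e2]
    linear_combination two_mul_Wmul_three_two_mul_add_one j / 2
  · obtain ⟨j, rfl⟩ : ∃ j, k = j + 1 := ⟨k - 1, by omega⟩
    obtain rfl : n = 2 * j + 1 + 1 := by omega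
    have e : (-1 : RatFunc ℚ) ^ (((j + 1 : ℕ) : ℤ) - 1) = (-1) ^ j := by
      rw [Nat.cast_succ, add_sub_cancel_right, zpow_natCast]
    rw [e]
    linear_combination two_mul_Wmul_three_two_mul j / 2
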